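/- Let m be a positive integer, let ψ be a gauge, and define the pseudogauge ζ(r) = ψ(r·√(m+1))/r^m. If ⟨E_n⟩ is an increasing sequence of subsets of ℝ with union E, then ν^ψ(E × [0,1]^m) ≤ sup_n ν_0^ζ(E_n), where ν^ψ is the lower box-counting measure on ℝ^{m+1} with gauge ψ and ν_0^ζ is the lower box-counting pre-measure on ℝ with pseudogauge ζ. -/

import Mathlib

open Filter Set Topology MeasureTheory
open scoped ENNReal NNReal

noncomputable section

/-- A gauge: nondecreasing on `[0,∞)`, right-continuous, `φ 0 = 0`, positive on `(0,∞)`. -/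
def IsGauge (φ : ℝ → ℝ) : Prop :=
  (∀ ⦃a b : ℝ⦄, 0 ≤ a → a ≤ b → φ a ≤ φ b) ∧
  (∀ a : ℝ, 0 ≤ a → ContinuousWithinAt φ (Set.Ici a) a) ∧
  φ 0 = 0 ∧ (∀ r : ℝ, 0 < r → 0 < φ r)

/-- `N_δ(E)`: the least number of sets of diameter at most `δ` needed to cover `E`. -/
def coverNum {X : Type*} [PseudoMetricSpace X] (δ : ℝ) (E : Set X) : ℝ≥0∞ :=
  ⨅ (n : ℕ) (_ : ∃ F : Fin n → Set X,
    (∀ i, EMetric.diam (F i) ≤ ENNReal.ofReal δ) ∧ E ⊆ ⋃ i, F i), (n : ℝ≥0∞)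

/-- `ν_0^ζ(E) = liminf_{δ→0+} N_δ(E)·ζ(δ)`. -/
def nu0 {X : Type*} [PseudoMetricSpace X] (ζ : ℝ → ℝ) (E : Set X) : ℝ≥0∞ :=
  Filter.liminf (fun δ : ℝ => coverNum δ E * ENNReal.ofReal (ζ δ)) (𝓝[>] (0:ℝ))

/-- The lower box-counting measure `ν^ζ`. -/
def lowerBoxMeasure {X : Type*} [PseudoMetricSpace X] (ζ : ℝ → ℝ) (E : Set X) : ℝ≥0∞ :=
  ⨅ (G : ℕ → Set X) (_ : E ⊆ ⋃ n, G n), ∑' n, nu0 ζ (G n)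

/-- The lower box dimension `lbdim E = liminf_{r→0+} log N_r(E)/|log r|`. -/
def lbdim {X : Type*} [PseudoMetricSpace X] (E : Set X) : EReal :=
  Filter.liminf (fun r : ℝ => ENNReal.log (coverNum r E) * ((|Real.log r|⁻¹ : ℝ) : EReal))
    (𝓝[>] (0:ℝ))

/-- The lower packing dimension. -/
def lpdim {X : Type*} [PseudoMetricSpace X] (E : Set X) : EReal :=
  ⨅ (G : ℕ → Set X) (_ : E ⊆ ⋃ n, G n), ⨆ n, lbdim (G n)

/-- The generalized lower scaled oscillation `lip_φ f`. -/
def lipGauge {X : Type*} [PseudoMetricSpace X] (φ : ℝ → ℝ) (f : X → ℝ) (x : X) : ℝ≥0∞ :=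
  Filter.liminf
    (fun r : ℝ => EMetric.diam (f '' Metric.closedBall x r) / ENNReal.ofReal (φ r))
    (𝓝[>] (0:ℝ))

/-- The upper scaled oscillation `Lip f`. -/
def LipGauge {X : Type*} [PseudoMetricSpace X] (φ : ℝ → ℝ) (f : X → ℝ) (x : X) : ℝ≥0∞ :=
  Filter.limsup
    (fun r : ℝ => EMetric.diam (f '' Metric.closedBall x r) / ENNReal.ofReal (φ r))
    (𝓝[>] (0:ℝ))

/-- The Hausdorff measure with gauge `ξ`. -/
def hausdorffGauge {X : Type*} [PseudoMetricSpace X] (ξ : ℝ → ℝ) (E : Set X) : ℝ≥0∞ :=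
  ⨆ (δ : ℝ) (_ : 0 < δ), ⨅ (G : ℕ → Set X) (_ : E ⊆ ⋃ n, G n)
    (_ : ∀ n, EMetric.diam (G n) ≤ ENNReal.ofReal δ),
    ∑' n, ENNReal.ofReal (ξ (EMetric.diam (G n)).toReal)

/-- A box in `ℝ^k`. -/
def IsBox {k : ℕ} (S : Set (EuclideanSpace ℝ (Fin k))) : Prop :=
  ∃ a b : Fin k → ℝ, S = {x | ∀ i, x i ∈ Set.Icc (a i) (b i)}

/-- A microscopic subset of `ℝ^k`. -/
def Microscopic {k : ℕ} (X : Set (EuclideanSpace ℝ (Fin k))) : Prop :=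
  ∀ ε : ℝ, 0 < ε → ∃ B : ℕ → Set (EuclideanSpace ℝ (Fin k)),
    (∀ n, IsBox (B n)) ∧ X ⊆ ⋃ n, B n ∧
    ∀ n, MeasureTheory.volume (B n) ≤ ENNReal.ofReal (ε ^ (n + 1))

/-- A microscopic subset of `ℝ`. -/
def MicroscopicR (E : Set ℝ) : Prop :=
  ∀ ε : ℝ, 0 < ε → ∃ I : ℕ → ℝ × ℝ,
    E ⊆ ⋃ n, Set.Icc (I n).1 (I n).2 ∧
    ∀ n, MeasureTheory.volume (Set.Icc (I n).1 (I n).2) ≤ ENNReal.ofReal (ε ^ (n + 1))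

end

theorem coverNum_le_card {X ι : Type*} [PseudoMetricSpace X] [Fintype ι] {δ : ℝ} {E : Set X}
    (F : ι → Set X) (hF : ∀ i, Metric.ediam (F i) ≤ ENNReal.ofReal δ) (hE : E ⊆ ⋃ i, F i) :
    coverNum δ E ≤ (Fintype.card ι : ℝ≥0∞) := by
  refine iInf₂_le (Fintype.card ι) ⟨fun i => F ((Fintype.equivFin ι).symm i), fun i => hF _, ?_⟩
  exact hE.trans_eq ((Fintype.equivFin ι).symm.iSup_comp (g := F)).symm

theorem coverNum_mono {X : Type*} [PseudoMetricSpace X] (δ : ℝ) {A B : Set X} (h : A ⊆ B) :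
    coverNum δ A ≤ coverNum δ B :=
  le_iInf₂ fun n ⟨F, hF, hB⟩ => iInf₂_le n ⟨F, hF, h.trans hB⟩

theorem coverNum_closure {X : Type*} [PseudoMetricSpace X] (δ : ℝ) (A : Set X) :
    coverNum δ (closure A) = coverNum δ A := by
  refine le_antisymm (le_iInf₂ fun n ⟨F, hF, hA⟩ => ?_) (coverNum_mono δ subset_closure)
  refine iInf₂_le n ⟨fun i => closure (F i), fun i => (Metric.ediam_closure _).le.trans (hF i), ?_⟩
  rw [← closure_iUnion_of_finite]
  exact closure_mono hA

theorem coverNum_union_ge {X : Type*} [PseudoMetricSpace X] {δ : ℝ} {A B : Set X} {r : ℝ≥0∞}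
    (hr : ∀ x ∈ A, ∀ y ∈ B, r ≤ edist x y) (hδ : ENNReal.ofReal δ < r) :
    coverNum δ A + coverNum δ B ≤ coverNum δ (A ∪ B) := by
  classical
  refine le_iInf₂ fun n ⟨F, hF, hAB⟩ => ?_
  have key : ∀ C : Set X, C ⊆ A ∪ B →
      coverNum δ C ≤ (Fintype.card {i : Fin n // (F i ∩ C).Nonempty} : ℝ≥0∞) := by
    intro C hC
    refine coverNum_le_card (fun i : {i : Fin n // (F i ∩ C).Nonempty} => F i)
      (fun i => hF i) fun x hx => ?_
    obtain ⟨i, hi⟩ := mem_iUnion.1 (hAB (hC hx))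
    exact mem_iUnion.2 ⟨⟨i, x, hi, hx⟩, hi⟩
  refine (add_le_add (key A subset_union_left) (key B subset_union_right)).trans ?_
  rw [← Nat.cast_add, Nat.cast_le, Fintype.card_subtype, Fintype.card_subtype,
    ← Finset.card_union_of_disjoint]
  · exact (Finset.card_le_univ _).trans_eq (Fintype.card_fin n)
  · rw [Finset.disjoint_filter]
    rintro i - ⟨x, hx, hxA⟩ ⟨y, hy, hyB⟩
    exact (hδ.trans_le (hr x hxA y hyB)).not_ge
      ((Metric.edist_le_ediam_of_mem hx hy).trans (hF i))

theorem nu0_mono {X : Type*} [PseudoMetricSpace X] (ζ : ℝ → ℝ) {A B : Set X} (h : A ⊆ B) :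
    nu0 ζ A ≤ nu0 ζ B :=
  liminf_le_liminf (.of_forall fun δ => mul_le_mul_left (coverNum_mono δ h) _)

theorem nu0_closure {X : Type*} [PseudoMetricSpace X] (ζ : ℝ → ℝ) (A : Set X) :
    nu0 ζ (closure A) = nu0 ζ A := by
  simp only [nu0, coverNum_closure]

theorem nu0_empty {X : Type*} [PseudoMetricSpace X] (ζ : ℝ → ℝ) : nu0 ζ (∅ : Set X) = 0 := by
  have h : ∀ δ, coverNum δ (∅ : Set X) = 0 := fun δ => by
    simpa using coverNum_le_card (δ := δ) (fun i : Empty => (∅ : Set X)) (by simp) (empty_subset _)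
  simp [nu0, h]

theorem nu0_union_ge {X : Type*} [PseudoMetricSpace X] (ζ : ℝ → ℝ) {A B : Set X}
    (h : Metric.AreSeparated A B) : nu0 ζ A + nu0 ζ B ≤ nu0 ζ (A ∪ B) := by
  obtain ⟨r, r0, hr⟩ := h
  have hδ : ∀ᶠ δ : ℝ in 𝓝[>] 0, ENNReal.ofReal δ < r := by
    refine (ENNReal.continuous_ofReal.tendsto' 0 0 ENNReal.ofReal_zero).mono_left
      nhdsWithin_le_nhds |>.eventually_lt_const (pos_iff_ne_zero.2 r0)
  unfold nu0
  rw [liminf_eq, liminf_eq, sSup_eq_iSup, sSup_eq_iSup]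
  refine ENNReal.biSup_add_biSup_le' ⟨0, by simp⟩ ⟨0, by simp⟩ fun a ha b hb => ?_
  refine le_liminf_of_le isCobounded_ge_of_top ?_
  filter_upwards [hδ, ha, hb] with δ hδ ha hb
  calc a + b ≤ _ := add_le_add ha hb
    _ = (coverNum δ A + coverNum δ B) * ENNReal.ofReal (ζ δ) := (add_mul _ _ _).symm
    _ ≤ _ := mul_le_mul_left (coverNum_union_ge hr hδ) _

/-- The lower box-counting measure as an outer measure. -/
noncomputable def lowerBoxOuterMeasure (X : Type*) [PseudoMetricSpace X] (ζ : ℝ → ℝ) : OuterMeasure X :=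
  OuterMeasure.ofFunction (nu0 ζ) (nu0_empty ζ)

theorem lowerBoxOuterMeasure_apply {X : Type*} [PseudoMetricSpace X] (ζ : ℝ → ℝ) (A : Set X) :
    lowerBoxOuterMeasure X ζ A = lowerBoxMeasure ζ A :=
  OuterMeasure.ofFunction_apply _ _ _

theorem lowerBoxOuterMeasure_isMetric {X : Type*} [MetricSpace X] (ζ : ℝ → ℝ) :
    (lowerBoxOuterMeasure X ζ).IsMetric := by
  intro A B hAB
  refine le_antisymm (measure_union_le _ _) ?_
  simp only [lowerBoxOuterMeasure_apply]
  refine le_iInf₂ fun G hG => ?_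
  have key : ∀ C : Set X, C ⊆ A ∪ B → lowerBoxMeasure ζ C ≤ ∑' n, nu0 ζ (G n ∩ C) := fun C hC =>
    iInf₂_le (fun n => G n ∩ C) (by rw [← iUnion_inter]; exact subset_inter (hC.trans hG) le_rfl)
  refine (add_le_add (key A subset_union_left) (key B subset_union_right)).trans ?_
  rw [← ENNReal.tsum_add]
  refine ENNReal.tsum_le_tsum fun n => ?_
  exact (nu0_union_ge ζ (hAB.mono inter_subset_right inter_subset_right)).trans
    (nu0_mono ζ (union_subset inter_subset_left inter_subset_left))

theorem lowerBoxMeasure_iUnion_le_iSup_nu0 {X : Type*} [MetricSpace X] (ζ : ℝ → ℝ)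
    {A : ℕ → Set X} (hA : Monotone A) :
    lowerBoxMeasure ζ (⋃ n, A n) ≤ ⨆ n, nu0 ζ (A n) := by
  borelize X
  let μ := (lowerBoxOuterMeasure X ζ).toMeasure (lowerBoxOuterMeasure_isMetric ζ).le_caratheodory
  calc lowerBoxMeasure ζ (⋃ n, A n) ≤ μ (⋃ n, A n) :=
        (lowerBoxOuterMeasure_apply ζ _).symm.le.trans (le_toMeasure_apply _ _ _)
    _ = ⨆ n, μ (A n) := hA.measure_iUnion
    _ ≤ ⨆ n, nu0 ζ (A n) := iSup_mono fun n => ?_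
  calc μ (A n) ≤ μ (closure (A n)) := measure_mono subset_closure
    _ = lowerBoxOuterMeasure X ζ (closure (A n)) :=
        toMeasure_apply _ _ isClosed_closure.measurableSet
    _ ≤ nu0 ζ (closure (A n)) := OuterMeasure.ofFunction_le _
    _ = nu0 ζ (A n) := nu0_closure ζ _

/-- The product `A × [0,1]^m` as a subset of Euclidean space. -/
def prodCube (m : ℕ) (A : Set ℝ) : Set (EuclideanSpace ℝ (Fin (m + 1))) :=
  {x | x 0 ∈ A ∧ ∀ i : Fin m, x i.succ ∈ Icc (0 : ℝ) 1}

theorem coverNum_prodCube_le (m : ℕ) {r : ℝ} (hr : 0 < r) (A : Set ℝ) :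
    coverNum (r * √(m + 1)) (prodCube m A) ≤
      ENNReal.ofReal (((1 + r) / r) ^ m) * coverNum r A := by
  have hpos : 0 < ((1 + r) / r) ^ m := by positivity
  rw [mul_comm (ENNReal.ofReal _), ← ENNReal.div_le_iff (by simpa using hpos) ENNReal.ofReal_ne_top]
  refine le_iInf₂ fun n ⟨F, hF, hA⟩ => ?_
  rw [ENNReal.div_le_iff (by simpa using hpos) ENNReal.ofReal_ne_top]
  set k : ℕ := ⌊1 / r⌋₊ + 1 with hk
  have hkr : (k : ℝ) ≤ (1 + r) / r := by
    have := Nat.floor_le (one_div_pos.2 hr).le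
    rw [hk, add_div, div_self hr.ne']
    push_cast
    linarith
  let G : Fin n × (Fin m → Fin k) → Set (EuclideanSpace ℝ (Fin (m + 1))) := fun p =>
    {x | x 0 ∈ F p.1 ∧ ∀ j : Fin m, x j.succ ∈ Icc (r * (p.2 j : ℕ)) (r * (p.2 j : ℕ) + r)}
  refine (coverNum_le_card G (fun p => ?_) fun x hx => ?_).trans ?_
  · refine Metric.ediam_le fun x hx y hy => ?_
    rw [edist_dist, EuclideanSpace.dist_eq]
    refine ENNReal.ofReal_le_ofReal ?_
    have hdist : ∀ i, dist (x i) (y i) ≤ r := by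
      refine Fin.cases ?_ fun j => ?_
      · have := (Metric.edist_le_ediam_of_mem hx.1 hy.1).trans (hF p.1)
        rwa [edist_dist, ENNReal.ofReal_le_ofReal_iff hr.le] at this
      · have := Real.dist_le_of_mem_Icc (hx.2 j) (hy.2 j)
        linarith
    refine Real.sqrt_le_iff.2 ⟨by positivity, ?_⟩
    calc ∑ i, dist (x i) (y i) ^ 2 ≤ ∑ _i : Fin (m + 1), r ^ 2 :=
          Finset.sum_le_sum fun i _ => pow_le_pow_left₀ dist_nonneg (hdist i) 2
      _ = (r * √(m + 1)) ^ 2 := by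
          rw [mul_pow, Real.sq_sqrt (by positivity)]
          simp
          ring
  · obtain ⟨i, hi⟩ := mem_iUnion.1 (hA hx.1)
    refine mem_iUnion.2 ⟨(i, fun j => ⟨⌊x j.succ / r⌋₊, Nat.lt_succ_of_le
      (Nat.floor_le_floor (div_le_div_of_nonneg_right (hx.2 j).2 hr.le))⟩), hi, fun j => ?_⟩
    have h1 := Nat.floor_le (div_nonneg (hx.2 j).1 hr.le)
    have h2 := (Nat.lt_floor_add_one (x j.succ / r)).le
    rw [le_div_iff₀ hr] at h1
    rw [div_le_iff₀ hr] at h2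
    constructor <;> dsimp only <;> linarith
  · simp only [Fintype.card_prod, Fintype.card_fin, Fintype.card_fun, Nat.cast_mul, Nat.cast_pow]
    refine mul_le_mul_right ?_ _
    rw [← ENNReal.ofReal_natCast, ← ENNReal.ofReal_pow (Nat.cast_nonneg k)]
    exact ENNReal.ofReal_le_ofReal (pow_le_pow_left₀ (Nat.cast_nonneg k) hkr m)

theorem nu0_prodCube_le (m : ℕ) (ψ : ℝ → ℝ) (A : Set ℝ) :
    nu0 ψ (prodCube m A) ≤ nu0 (fun r => ψ (r * √(m + 1)) / r ^ m) A := by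
  have hmap : Tendsto (fun r : ℝ => r * √(m + 1)) (𝓝[>] 0) (𝓝[>] 0) := by
    refine tendsto_nhdsWithin_iff.2 ⟨?_, ?_⟩
    · exact ((continuous_mul_const _).tendsto' 0 0 (zero_mul _)).mono_left nhdsWithin_le_nhds
    · filter_upwards [self_mem_nhdsWithin] with r (hr : 0 < r)
      exact mul_pos hr (Real.sqrt_pos.2 (by positivity))
  let c : ℝ → ℝ≥0∞ := fun r => ENNReal.ofReal ((1 + r) ^ m)
  let f : ℝ → ℝ≥0∞ := fun r => coverNum r A * ENNReal.ofReal (ψ (r * √(m + 1)) / r ^ m)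
  have hc : limsup c (𝓝[>] 0) = 1 := by
    refine Tendsto.limsup_eq (Tendsto.mono_left ?_ nhdsWithin_le_nhds)
    exact (show Continuous c from ENNReal.continuous_ofReal.comp (by fun_prop)).tendsto' 0 1 (by simp [c])
  calc nu0 ψ (prodCube m A)
      ≤ liminf (fun r : ℝ => coverNum (r * √(m + 1)) (prodCube m A) *
          ENNReal.ofReal (ψ (r * √(m + 1)))) (𝓝[>] 0) := liminf_le_liminf_of_le hmap
    _ ≤ liminf (c * f) (𝓝[>] 0) := by
        refine liminf_le_liminf ?_
        filter_upwards [self_mem_nhdsWithin] with r (hr : 0 < r)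
        refine (mul_le_mul_left (coverNum_prodCube_le m hr A) _).trans_eq ?_
        simp only [Pi.mul_apply, c, f]
        rw [div_pow, div_eq_mul_inv, div_eq_mul_inv (ψ _),
          ENNReal.ofReal_mul (by positivity), ENNReal.ofReal_mul' (by positivity)]
        ring
    _ ≤ limsup c (𝓝[>] 0) * liminf f (𝓝[>] 0) :=
        ENNReal.liminf_mul_le (.inl (by simp [hc])) (.inl (by simp [hc]))
    _ = nu0 (fun r => ψ (r * √(m + 1)) / r ^ m) A := by rw [hc, one_mul]; rfl

theorem stmt11
    (m : ℕ) (hm : 0 < m) (ψ : ℝ → ℝ) (hψ : IsGauge ψ)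
    (E : ℕ → Set ℝ) (hE : Monotone E) :
    lowerBoxMeasure ψ
      {x : EuclideanSpace ℝ (Fin (m + 1)) |
        (x 0 ∈ ⋃ n, E n) ∧ ∀ i : Fin m, x i.succ ∈ Set.Icc (0:ℝ) 1}
      ≤ ⨆ n, nu0 (fun r => ψ (r * Real.sqrt (m + 1)) / r ^ m) (E n) := by
  have hset : {x : EuclideanSpace ℝ (Fin (m + 1)) |
      (x 0 ∈ ⋃ n, E n) ∧ ∀ i : Fin m, x i.succ ∈ Set.Icc (0:ℝ) 1} = ⋃ n, prodCube m (E n) := by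
    ext x
    simp [prodCube]
  rw [hset]
  have hmono : Monotone fun n => prodCube m (E n) := fun a b hab x hx => ⟨hE hab hx.1, hx.2⟩
  exact (lowerBoxMeasure_iUnion_le_iSup_nu0 ψ hmono).trans
    (iSup_mono fun n => nu0_prodCube_le m ψ (E n))
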